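/- Let α > 0, let ν be a Borel probability measure on ℝ₊, let T, L > 1, let p > 0 and M > 1, let ε_n ↓ 0 be a decreasing sequence in (0,1), and for each n ∈ ℕ let l_n, κ_n, γ_n > 0 satisfy l_n < ε_n/(32α), κ_n < l_n/(2M), γ_n < (κ_n ε_n/4) ∧ (l_n/4). Then for every ε > 0 there exist δ > 0 and n_ε ∈ ℕ such that for every n > n_ε, every r > 0, and every processor-sharing path that satisfies, for all n' ≤ n, the level-(ε_{n'}, l_{n'}, κ_{n'}, γ_{n'}, M) properties (for r, T, L), one has sup_{0≤m≤⌊rT⌋} w_L(μ̄^{r,m}(·), δ) ≤ ε, where w_L(ζ(·), δ) = sup_{t∈[0,L−δ]} sup_{h∈[0,δ]} d[ζ(t+h), ζ(t)]. -/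

import Mathlib

open MeasureTheory Filter Set
noncomputable section
namespace PSQ

/-- ⟨g, ζ⟩ = ∫ g dζ -/
def pair (g : ℝ → ℝ) (ζ : Measure ℝ) : ℝ := ∫ x, g x ∂ζ

/-- total mass ⟨1, ζ⟩ of a finite measure, as a real number -/
def mass (ζ : Measure ℝ) : ℝ := (ζ Set.univ).toReal

/-- truncated Dirac measure δ⁺ₓ -/
def dplus (x : ℝ) : Measure ℝ := if 0 < x then Measure.dirac x else 0

/-- positive part x⁺ -/
def pos (x : ℝ) : ℝ := max x 0

/-- the arrival counting process E(t) = sup{i : U i ≤ t} -/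
def Ecount (U : ℕ → ℝ) (t : ℝ) : ℕ := sSup {i : ℕ | U i ≤ t}

/-- the standing hypotheses on the data of a pathwise processor sharing queue:
nondecreasing arrival times with `U 0 = 0`, `U 1 > 0`, `U i → ∞`, and strictly positive
service times and initial service times. -/
def QueueHyps (U v : ℕ → ℝ) (Z0 : ℕ) (vt : ℕ → ℝ) : Prop :=
  U 0 = 0 ∧ Monotone U ∧ 0 < U 1 ∧ Tendsto U atTop atTop ∧
    (∀ i, 1 ≤ i → 0 < v i) ∧ (∀ j, 1 ≤ j → 0 < vt j)

/-- the defining equations of the state descriptor μ and the cumulative service per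
job S:  `S t = ∫_0^t φ(⟨1, μ(s)⟩) ds` (recall `(0:ℝ)⁻¹ = 0` in Lean, matching φ(0)=0)
and `μ(t) = Σ_j δ⁺_{(ṽ_j - S(t))⁺} + Σ_{i ≤ E(t)} δ⁺_{(v_i - S(t) + S(U_i))⁺}`. -/
def StateEqns (U v : ℕ → ℝ) (Z0 : ℕ) (vt : ℕ → ℝ)
    (μ : ℝ → Measure ℝ) (S : ℝ → ℝ) : Prop :=
  ∀ t, 0 ≤ t →
    (S t = ∫ s in (0:ℝ)..t, (mass (μ s))⁻¹) ∧
    μ t = (∑ j ∈ Finset.range Z0, dplus (pos (vt (j+1) - S t)))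
        + ∑ i ∈ Finset.range (Ecount U t), dplus (pos (v (i+1) - S t + S (U (i+1))))

/-- fluid scaled state descriptor μ̄^r(t) = r⁻¹ μ(rt) -/
def fmu (μ : ℝ → Measure ℝ) (r t : ℝ) : Measure ℝ := ENNReal.ofReal (1/r) • μ (r*t)

/-- fluid scaled arrival process Ē^r(t) = r⁻¹ E(rt) -/
def fE (U : ℕ → ℝ) (r t : ℝ) : ℝ := (Ecount U (r*t) : ℝ) / r

/-- fluid scaled cumulative service S̄^r_{t,t'} = S(r t') - S(r t) -/
def fS (S : ℝ → ℝ) (r t t' : ℝ) : ℝ := S (r*t') - S (r*t)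

end PSQ
end

namespace PSQ

/-- The constraints tying together the constants of the good-path properties:
`ε ∈ (0,1)`, `l, p, κ, γ > 0`, `M > 1`, `l < ε/(32α)`, `κ < l/(2M)`,
`γ < (κε/4) ∧ (l/4)`. -/
def GoodConsts (α ε l p κ γ M : ℝ) : Prop :=
  ε ∈ Set.Ioo (0:ℝ) 1 ∧ 0 < l ∧ 0 < p ∧ 0 < κ ∧ 0 < γ ∧ 1 < M ∧
    l < ε/(32*α) ∧ κ < l/(2*M) ∧ γ < min (κ*ε/4) (l/4)

/-- A processor sharing path satisfies the level-(ε, l, κ, γ, M) good-path properties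
(for r, T, L), with `N = ⌈64M²/(κε²)⌉ + 1`. -/
def GoodPath (U v : ℕ → ℝ) (μ : ℝ → Measure ℝ) (ν : Measure ℝ)
    (T L r ε l p κ γ M : ℝ) : Prop :=
  ∀ m : ℕ, m ≤ ⌊r * T⌋₊ →
    (∀ t ∈ Set.Icc (0:ℝ) L, fE U r ((m:ℝ) + t + l) - fE U r ((m:ℝ) + t) ≤ ε/16) ∧
    (∀ t ∈ Set.Icc (0:ℝ) L,
      max (max (mass (fmu μ r ((m:ℝ)+t))) (pair id (fmu μ r ((m:ℝ)+t))))
        (pair (fun x => x ^ ((1:ℝ)+p)) (fmu μ r ((m:ℝ)+t))) ≤ M) ∧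
    (∀ x : ℝ, 0 ≤ x → ((fmu μ r 0) (Set.Icc x (x+κ))).toReal ≤ ε/4) ∧
    (∀ t ∈ Set.Icc (0:ℝ) L,
      |pair id (fmu μ r ((m:ℝ)+t)) - pair id (fmu μ r (m:ℝ))| ≤ γ/4) ∧
    (∀ t ∈ Set.Icc (0:ℝ) L, ∀ k : ℕ, k ≤ ⌈64*M^2/(κ*ε^2)⌉₊ + 1 →
      (1/r) * (∑ i ∈ Finset.Ioc (Ecount U (r*((m:ℝ)+t))) (Ecount U (r*((m:ℝ)+t+l))),
          if (k:ℝ)*κ ≤ v i ∧ v i < ((k:ℝ)+1)*κ then (1:ℝ) else 0)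
        ≤ (ε/8) * (ν (Set.Ico (((k:ℝ)-1/2)*κ) (((k:ℝ)+3/2)*κ))).toReal)

end PSQ

namespace PSQ

/-- the metric d on finite measures built from the families (g_k), (h_k)
(with 0-based indexing, so `g k` plays the role of the paper's `g_{k+1}`). -/
noncomputable def dmet (g h : ℕ → ℝ → ℝ) (ζ₁ ζ₂ : Measure ℝ) : ℝ :=
  (∑' k : ℕ, (2:ℝ)⁻¹^(k+1) * min |pair (g k) ζ₁ - pair (g k) ζ₂| 1)
    + ⨆ k : ℕ, |pair (h k) ζ₁ - pair (h k) ζ₂|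

/-- the hypotheses on the families (g_k), (h_k) defining the metric d (0-based
indexing: `h k` vanishes on [0,k] and equals 1 on [k+1,∞), i.e. it is the paper's
`h_{k+1}`); the family (g_k) is convergence determining for weak convergence of
finite Borel measures on ℝ₊. -/
def MetricFamilies (g h : ℕ → ℝ → ℝ) : Prop :=
  (∀ k, (∀ x, 0 ≤ g k x ∧ g k x ≤ 1) ∧ ContDiff ℝ 1 (g k) ∧ ∃ C, ∀ x, |deriv (g k) x| ≤ C) ∧
  (∀ k, (∀ x, 0 ≤ h k x ∧ h k x ≤ 1) ∧ ContDiff ℝ 1 (h k) ∧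
    (∀ x ∈ Set.Icc (0:ℝ) (k:ℝ), h k x = 0) ∧ (∀ x, (k:ℝ)+1 ≤ x → h k x = 1) ∧
    (∀ x, |deriv (h k) x| ≤ 2)) ∧
  (∀ (ζs : ℕ → Measure ℝ) (ζ : Measure ℝ),
    (∀ j, IsFiniteMeasure (ζs j)) → IsFiniteMeasure ζ →
    (∀ j, ζs j (Set.Iio 0) = 0) → ζ (Set.Iio 0) = 0 →
    (∀ k, Tendsto (fun j => pair (g k) (ζs j)) atTop (nhds (pair (g k) ζ))) →
    ∀ f : ℝ → ℝ, Continuous f → (∃ C, ∀ x, |f x| ≤ C) →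
      Tendsto (fun j => pair f (ζs j)) atTop (nhds (pair f ζ)))

end PSQ
namespace PSQ

variable {U v : ℕ → ℝ} {Z0 : ℕ} {vt : ℕ → ℝ} {μ : ℝ → Measure ℝ} {S : ℝ → ℝ}

lemma le_Ecount_iff (hQ : QueueHyps U v Z0 vt)
    {t : ℝ} (ht : 0 ≤ t) (i : ℕ) : i ≤ Ecount U t ↔ U i ≤ t := by
  obtain ⟨h0, hmono, -, hlim, -, -⟩ := hQ
  have hbdd : BddAbove {i : ℕ | U i ≤ t} := by
    obtain ⟨n, hn⟩ := (hlim.eventually_gt_atTop t).exists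
    refine ⟨n, fun j (hj : U j ≤ t) => ?_⟩
    by_contra! hlt
    exact absurd (hmono hlt.le) (by linarith)
  have hmem : U (Ecount U t) ≤ t := Nat.sSup_mem (s := {i : ℕ | U i ≤ t}) ⟨0, by simpa [h0]⟩ hbdd
  exact ⟨fun h => (hmono h).trans hmem, fun h => le_csSup hbdd h⟩

lemma Ecount_mono (hQ : QueueHyps U v Z0 vt)
    {s t : ℝ} (hs : 0 ≤ s) (hst : s ≤ t) : Ecount U s ≤ Ecount U t :=
  (le_Ecount_iff hQ (hs.trans hst) _).2 (((le_Ecount_iff hQ hs _).1 le_rfl).trans hst)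

/-- The sum of `F` over the residual service times (negative once a job has left) at time `t`
of all jobs that have been in the system. -/
noncomputable def jobSum (U v : ℕ → ℝ) (Z0 : ℕ) (vt : ℕ → ℝ) (S : ℝ → ℝ) (F : ℝ → ℝ) (t : ℝ) : ℝ :=
  ∑ j ∈ Finset.range Z0, F (vt (j + 1) - S t)
    + ∑ i ∈ Finset.range (Ecount U t), F (v (i + 1) - S t + S (U (i + 1)))

lemma jobSum_mono {F G : ℝ → ℝ}
    (h : ∀ x, F x ≤ G x) (t : ℝ) : jobSum U v Z0 vt S F t ≤ jobSum U v Z0 vt S G t :=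
  add_le_add (Finset.sum_le_sum fun _ _ => h _) (Finset.sum_le_sum fun _ _ => h _)

lemma jobSum_nonneg {F : ℝ → ℝ}
    (h : ∀ x, 0 ≤ F x) (t : ℝ) : 0 ≤ jobSum U v Z0 vt S F t :=
  add_nonneg (Finset.sum_nonneg fun _ _ => h _) (Finset.sum_nonneg fun _ _ => h _)

lemma jobSum_add (F G : ℝ → ℝ) (t : ℝ) :
    jobSum U v Z0 vt S (fun x => F x + G x) t =
      jobSum U v Z0 vt S F t + jobSum U v Z0 vt S G t := by
  simp only [jobSum, Finset.sum_add_distrib]; ring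

lemma jobSum_const_mul (c : ℝ) (F : ℝ → ℝ)
    (t : ℝ) : jobSum U v Z0 vt S (fun x => c * F x) t = c * jobSum U v Z0 vt S F t := by
  simp only [jobSum, ← Finset.mul_sum]; ring

lemma abs_jobSum_le (F : ℝ → ℝ)
    (t : ℝ) : |jobSum U v Z0 vt S F t| ≤ jobSum U v Z0 vt S (fun x => |F x|) t :=
  (abs_add_le _ _).trans
    (add_le_add (Finset.abs_sum_le_sum_abs _ _) (Finset.abs_sum_le_sum_abs _ _))

/-- Residual service times at time `t'` are those at time `t`, shifted by the service received in
between, together with the contribution of the arrivals during `(t, t']`. -/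
lemma jobSum_eq_add (hQ : QueueHyps U v Z0 vt) (S : ℝ → ℝ)
    (F : ℝ → ℝ) {t t' : ℝ} (ht : 0 ≤ t) (htt' : t ≤ t') :
    jobSum U v Z0 vt S F t' = jobSum U v Z0 vt S (fun x => F (x - (S t' - S t))) t
      + ∑ i ∈ Finset.Ioc (Ecount U t) (Ecount U t'), F (v i - S t' + S (U i)) := by
  have hE := Ecount_mono hQ ht htt'
  have hsum : ∑ i ∈ Finset.Ioc (Ecount U t) (Ecount U t'), F (v i - S t' + S (U i)) =
      ∑ i ∈ Finset.Ico (Ecount U t) (Ecount U t'), F (v (i + 1) - S t' + S (U (i + 1))) := by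
    rw [Finset.sum_Ico_add' (fun i => F (v i - S t' + S (U i)))]
    congr 1
    ext i
    simp only [Finset.mem_Ioc, Finset.mem_Ico]
    omega
  rw [hsum, jobSum, jobSum, ← Finset.sum_range_add_sum_Ico _ hE, ← add_assoc]
  congr 3
  · exact funext fun _ => congrArg F (by ring)
  · exact funext fun _ => congrArg F (by ring)

lemma integrable_dplus (f : ℝ → ℝ) (x : ℝ) : Integrable f (dplus x) := by
  unfold dplus
  split_ifs
  · exact integrable_dirac (by simp)
  · exact integrable_zero_measure

lemma integral_dplus_pos (f : ℝ → ℝ) (x : ℝ) :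
    ∫ y, f y ∂(dplus (pos x)) = if 0 < x then f x else 0 := by
  unfold dplus pos
  rcases lt_or_ge 0 x with hx | hx
  · simp [hx, max_eq_left hx.le]
  · simp [hx, hx.not_gt]

lemma pair_eq_jobSum
    (hμ : StateEqns U v Z0 vt μ S) (f : ℝ → ℝ) {t : ℝ} (ht : 0 ≤ t) :
    pair f (μ t) = jobSum U v Z0 vt S (fun x => if 0 < x then f x else 0) t := by
  rw [pair, (hμ t ht).2, integral_add_measure, integral_finsetSum_measure,
    integral_finsetSum_measure]
  · simp only [integral_dplus_pos, jobSum]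
  · exact fun _ _ => integrable_dplus _ _
  · exact fun _ _ => integrable_dplus _ _
  · exact integrable_finsetSum_measure.2 fun _ _ => integrable_dplus _ _
  · exact integrable_finsetSum_measure.2 fun _ _ => integrable_dplus _ _

lemma pair_fmu
    (hμ : StateEqns U v Z0 vt μ S) (f : ℝ → ℝ) {r u : ℝ} (hr : 0 < r) (hu : 0 ≤ u) :
    pair f (fmu μ r u) =
      (1 / r) * jobSum U v Z0 vt S (fun x => if 0 < x then f x else 0) (r * u) := by
  rw [← pair_eq_jobSum hμ f (by positivity), pair, fmu, integral_smul_measure,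
    ENNReal.toReal_ofReal (by positivity), smul_eq_mul, pair]

lemma mass_eq_pair (ζ : Measure ℝ) : mass ζ = pair (fun _ => 1) ζ := by
  simp [mass, pair, Measure.real]

lemma toReal_apply_eq_pair (ζ : Measure ℝ) {A : Set ℝ} (hA : MeasurableSet A) :
    (ζ A).toReal = pair (A.indicator 1) ζ := by
  rw [pair, integral_indicator_one hA, Measure.real]

lemma mass_eq_jobSum
    (hμ : StateEqns U v Z0 vt μ S) {t : ℝ} (ht : 0 ≤ t) :
    mass (μ t) = jobSum U v Z0 vt S (fun x => if 0 < x then 1 else 0) t := by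
  rw [mass_eq_pair, pair_eq_jobSum hμ _ ht]

lemma inv_mass_mem_Icc
    (hμ : StateEqns U v Z0 vt μ S) {t : ℝ} (ht : 0 ≤ t) :
    (mass (μ t))⁻¹ ∈ Icc (0 : ℝ) 1 := by
  have : ∃ n : ℕ, mass (μ t) = n := by
    refine ⟨((Finset.range Z0).filter fun j => 0 < vt (j + 1) - S t).card +
      ((Finset.range (Ecount U t)).filter fun i => 0 < v (i + 1) - S t + S (U (i + 1))).card, ?_⟩
    rw [mass_eq_jobSum hμ ht, jobSum]
    simp
  obtain ⟨n, hn⟩ := this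
  rw [hn]
  exact ⟨by positivity, Nat.cast_inv_le_one n⟩

lemma intervalIntegrable_inv_mass (hQ : QueueHyps U v Z0 vt) (hμ : StateEqns U v Z0 vt μ S) {b : ℝ} (hb : 0 ≤ b) :
    IntervalIntegrable (fun s => (mass (μ s))⁻¹) volume 0 b := by
  set f : ℝ → ℝ := fun s => (mass (μ s))⁻¹ with hf
  set A : Set ℝ := {t | t ∈ Icc 0 b ∧ IntervalIntegrable f volume 0 t} with hA
  have hAm : MeasurableSet A := by
    refine Set.OrdConnected.measurableSet (ordConnected_def.2 ?_)
    rintro x ⟨hx, -⟩ y ⟨hy, hyi⟩ z hz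
    exact ⟨⟨hx.1.trans hz.1, hz.2.trans hy.2⟩, hyi.mono_set
      (by rw [uIcc_of_le (hx.1.trans hz.1), uIcc_of_le hy.1]; exact Icc_subset_Icc_right hz.2)⟩
  have hS1 : AEMeasurable S (volume.restrict A) := by
    refine aemeasurable_restrict_of_monotoneOn hAm ?_
    rintro x ⟨hx, hxi⟩ y ⟨hy, hyi⟩ hxy
    rw [(hμ x hx.1).1, (hμ y hy.1).1]
    refine intervalIntegral.integral_mono_interval le_rfl hx.1 hxy ?_ hyi
    filter_upwards [ae_restrict_mem measurableSet_Ioc] with s hs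
    exact (inv_mass_mem_Icc hμ hs.1.le).1
  have hS2 : AEMeasurable S (volume.restrict (Icc 0 b \ A)) := by
    refine (aemeasurable_const (b := (0 : ℝ))).congr ?_
    filter_upwards [ae_restrict_mem (measurableSet_Icc.diff hAm)] with s hs
    rw [(hμ s hs.1.1).1, intervalIntegral.integral_undef]
    exact fun hi => hs.2 ⟨hs.1, hi⟩
  have hS : AEMeasurable S (volume.restrict (Icc 0 b)) := by
    have := aemeasurable_union_iff.2 ⟨hS1, hS2⟩
    rwa [union_sdiff_cancel (fun x hx => hx.1)] at this
  have hmass : AEMeasurable (fun t => mass (μ t)) (volume.restrict (Icc 0 b)) := by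
    have hpos : Measurable fun x : ℝ => if 0 < x then (1 : ℝ) else 0 :=
      Measurable.ite measurableSet_Ioi measurable_const measurable_const
    have : AEMeasurable (fun t => ∑ j ∈ Finset.range Z0,
        (if 0 < vt (j + 1) - S t then (1 : ℝ) else 0) + ∑ i ∈ Finset.range (Ecount U b),
        (Ici (U (i + 1))).indicator 1 t *
          (if 0 < v (i + 1) - S t + S (U (i + 1)) then (1 : ℝ) else 0))
        (volume.restrict (Icc 0 b)) := by
      refine AEMeasurable.add (Finset.aemeasurable_fun_sum _ fun j _ => ?_)
        (Finset.aemeasurable_fun_sum _ fun i _ => AEMeasurable.mul ?_ ?_)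
      · exact hpos.comp_aemeasurable (hS.const_sub _)
      · exact (measurable_one.indicator measurableSet_Ici).aemeasurable
      · exact hpos.comp_aemeasurable ((hS.const_sub _).add_const _)
    refine this.congr ?_
    filter_upwards [ae_restrict_mem measurableSet_Icc] with t ht
    rw [mass_eq_jobSum hμ ht.1, jobSum]
    congr 1
    symm
    refine Finset.sum_subset_zero_on_sdiff
      (Finset.range_subset_range.2 (Ecount_mono hQ ht.1 ht.2)) ?_ ?_
    · intro i hi
      simp only [Finset.mem_sdiff, Finset.mem_range, not_lt] at hi
      have : ¬ U (i + 1) ≤ t := fun h => by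
        have := (le_Ecount_iff hQ ht.1 (i + 1)).2 h
        omega
      simp [this]
    · intro i hi
      have : U (i + 1) ≤ t := (le_Ecount_iff hQ ht.1 (i + 1)).1 (Finset.mem_range.1 hi)
      simp [this]
  rw [intervalIntegrable_iff_integrableOn_Icc_of_le hb]
  refine Integrable.mono' (g := fun _ => (1 : ℝ)) (by simp)
    hmass.inv.aestronglyMeasurable ?_
  filter_upwards [ae_restrict_mem measurableSet_Icc] with s hs
  obtain ⟨h0, h1⟩ := inv_mass_mem_Icc hμ hs.1
  rwa [Real.norm_of_nonneg h0]

lemma service_sub_eq_integral (hQ : QueueHyps U v Z0 vt) (hμ : StateEqns U v Z0 vt μ S) {a b : ℝ}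
    (ha : 0 ≤ a) (hab : a ≤ b) : S b - S a = ∫ s in a..b, (mass (μ s))⁻¹ := by
  rw [(hμ b (ha.trans hab)).1, (hμ a ha).1]
  exact intervalIntegral.integral_interval_sub_left
    (intervalIntegrable_inv_mass hQ hμ (ha.trans hab)) (intervalIntegrable_inv_mass hQ hμ ha)

lemma intervalIntegrable_inv_mass_of_le (hQ : QueueHyps U v Z0 vt) (hμ : StateEqns U v Z0 vt μ S)
    {a b : ℝ} (ha : 0 ≤ a) (hab : a ≤ b) :
    IntervalIntegrable (fun s => (mass (μ s))⁻¹) volume a b :=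
  (intervalIntegrable_inv_mass hQ hμ ha).symm.trans
    (intervalIntegrable_inv_mass hQ hμ (ha.trans hab))

lemma service_mono (hQ : QueueHyps U v Z0 vt) (hμ : StateEqns U v Z0 vt μ S) {a b : ℝ}
    (ha : 0 ≤ a) (hab : a ≤ b) : S a ≤ S b := by
  rw [← sub_nonneg, service_sub_eq_integral hQ hμ ha hab]
  exact intervalIntegral.integral_nonneg hab
    fun s hs => (inv_mass_mem_Icc hμ (ha.trans hs.1)).1

lemma service_sub_le (hQ : QueueHyps U v Z0 vt) (hμ : StateEqns U v Z0 vt μ S) {a b c : ℝ}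
    (ha : 0 ≤ a) (hab : a ≤ b) (hc : 0 < c) (h : ∀ s ∈ Icc a b, c ≤ mass (μ s)) :
    S b - S a ≤ (b - a) / c := by
  rw [service_sub_eq_integral hQ hμ ha hab]
  calc ∫ s in a..b, (mass (μ s))⁻¹ ≤ ∫ s in a..b, c⁻¹ :=
        intervalIntegral.integral_mono_on hab (intervalIntegrable_inv_mass_of_le hQ hμ ha hab)
          (by simp) fun s hs => inv_anti₀ hc (h s hs)
    _ = (b - a) / c := by simp [div_eq_mul_inv]

lemma le_service_sub (hQ : QueueHyps U v Z0 vt) (hμ : StateEqns U v Z0 vt μ S) {a b C : ℝ}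
    (ha : 0 ≤ a) (hab : a ≤ b) (h : ∀ s ∈ Icc a b, 0 < mass (μ s) ∧ mass (μ s) ≤ C) :
    (b - a) / C ≤ S b - S a := by
  rw [service_sub_eq_integral hQ hμ ha hab]
  calc (b - a) / C = ∫ s in a..b, C⁻¹ := by simp [div_eq_mul_inv]
    _ ≤ ∫ s in a..b, (mass (μ s))⁻¹ :=
        intervalIntegral.integral_mono_on hab (by simp)
          (intervalIntegrable_inv_mass_of_le hQ hμ ha hab)
          fun s hs => inv_anti₀ (h s hs).1 (h s hs).2

lemma jobSum_le_add_arrivals (hQ : QueueHyps U v Z0 vt) {F : ℝ → ℝ} (hF : ∀ x, F x ≤ 1)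
    {t t' : ℝ} (ht : 0 ≤ t) (htt' : t ≤ t') :
    jobSum U v Z0 vt S F t' ≤ jobSum U v Z0 vt S (fun x => F (x - (S t' - S t))) t
      + ((Ecount U t' : ℝ) - Ecount U t) := by
  rw [jobSum_eq_add hQ S F ht htt']
  gcongr
  calc _ ≤ ∑ i ∈ Finset.Ioc (Ecount U t) (Ecount U t'), (1 : ℝ) :=
        Finset.sum_le_sum fun _ _ => hF _
    _ = _ := by simp [Nat.cast_sub (Ecount_mono hQ ht htt')]

lemma sum_Icc_sub_shift_two (H : ℕ → ℝ) {a b : ℕ} (hab : a ≤ b) :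
    ∑ k ∈ Finset.Icc a b, (H k - H (k + 2)) = H a + H (a + 1) - H (b + 1) - H (b + 2) := by
  induction b, hab using Nat.le_induction with
  | base => simp
  | succ n hn ih => rw [Finset.sum_Icc_succ_top (by omega), ih]; ring

lemma toReal_Ico_eq_sub (ν : Measure ℝ) [IsFiniteMeasure ν] {x y : ℝ} (hxy : x ≤ y) :
    (ν (Ico x y)).toReal = (ν (Ici x)).toReal - (ν (Ici y)).toReal := by
  have h : Ici x = Ico x y ∪ Ici y := (Ico_union_Ici_eq_Ici hxy).symm
  have hd : Disjoint (Ico x y) (Ici y) :=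
    Set.disjoint_left.2 fun z hz hz' => absurd hz.2 (not_lt.2 hz')
  rw [h, measure_union hd measurableSet_Ici,
    ENNReal.toReal_add (measure_ne_top _ _) (measure_ne_top _ _)]
  ring

lemma toReal_Ici_antitone (ν : Measure ℝ) [IsFiniteMeasure ν] :
    Antitone fun x => (ν (Ici x)).toReal := fun _ _ h =>
  ENNReal.toReal_mono (measure_ne_top _ _) (measure_mono (Ici_subset_Ici.2 h))

lemma sum_bins_le (ν : Measure ℝ) [IsFiniteMeasure ν] {κ y z : ℝ} (hκ : 0 < κ) (hy : 0 ≤ y)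
    (hyz : y ≤ z) :
    ∑ k ∈ Finset.Icc ⌊y / κ⌋₊ ⌊z / κ⌋₊,
        (ν (Ico (((k : ℝ) - 1 / 2) * κ) (((k : ℝ) + 3 / 2) * κ))).toReal ≤
      2 * ((ν (Ici (y - 3 / 2 * κ))).toReal - (ν (Ici (z + 3 / 2 * κ))).toReal) := by
  set H : ℕ → ℝ := fun k => (ν (Ici (((k : ℝ) - 1 / 2) * κ))).toReal with hH
  have hanti := toReal_Ici_antitone ν
  have hsum : ∑ k ∈ Finset.Icc ⌊y / κ⌋₊ ⌊z / κ⌋₊,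
        (ν (Ico (((k : ℝ) - 1 / 2) * κ) (((k : ℝ) + 3 / 2) * κ))).toReal =
      ∑ k ∈ Finset.Icc ⌊y / κ⌋₊ ⌊z / κ⌋₊, (H k - H (k + 2)) := by
    refine Finset.sum_congr rfl fun k _ => ?_
    rw [toReal_Ico_eq_sub ν (by nlinarith)]
    simp only [hH]
    push_cast
    ring_nf
  have hya : y < (⌊y / κ⌋₊ + 1 : ℝ) * κ := (div_lt_iff₀ hκ).1 (Nat.lt_floor_add_one _)
  have hzb : (⌊z / κ⌋₊ : ℝ) * κ ≤ z :=
    (le_div_iff₀ hκ).1 (Nat.floor_le (div_nonneg (hy.trans hyz) hκ.le))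
  rw [hsum, sum_Icc_sub_shift_two _ (Nat.floor_le_floor (by gcongr))]
  have h1 : H ⌊y / κ⌋₊ ≤ (ν (Ici (y - 3 / 2 * κ))).toReal := hanti (by nlinarith)
  have h2 : H (⌊y / κ⌋₊ + 1) ≤ (ν (Ici (y - 3 / 2 * κ))).toReal :=
    hanti (by push_cast; nlinarith)
  have h3 : (ν (Ici (z + 3 / 2 * κ))).toReal ≤ H (⌊z / κ⌋₊ + 1) :=
    hanti (by push_cast; nlinarith)
  have h4 : (ν (Ici (z + 3 / 2 * κ))).toReal ≤ H (⌊z / κ⌋₊ + 2) :=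
    hanti (by push_cast; nlinarith)
  linarith

/-- Indicator of the window `[y, y + κ]`, restricted to positive residual service times. -/
noncomputable def window (κ y : ℝ) : ℝ → ℝ :=
  fun x => if 0 < x then (Icc y (y + κ)).indicator 1 x else 0

lemma window_nonneg (κ y x : ℝ) : 0 ≤ window κ y x := by
  unfold window indicator; split_ifs <;> simp

lemma window_le_one (κ y x : ℝ) : window κ y x ≤ 1 := by
  unfold window indicator; split_ifs <;> simp

lemma window_le_of_mem {κ y x c : ℝ} (hc : 0 ≤ c)
    (h : 0 < x → y ≤ x → x ≤ y + κ → 1 ≤ c) : window κ y x ≤ c := by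
  unfold window indicator
  split_ifs with h1 h2
  · exact h h1 h2.1 h2.2
  · exact hc
  · exact hc

lemma window_eq_one {κ y x : ℝ} (h : 0 < x) (h1 : y ≤ x) (h2 : x ≤ y + κ) : window κ y x = 1 := by
  simp [window, h, h1, h2]

lemma window_sub_le {κ y x Δ : ℝ} (hΔ : 0 ≤ Δ) : window κ y (x - Δ) ≤ window κ (y + Δ) x :=
  window_le_of_mem (window_nonneg _ _ _) fun h h1 h2 =>
    (window_eq_one (by linarith) (by linarith) (by linarith)).ge

/-- Contribution of the arrivals during one time block to the mass of a window. -/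
lemma sum_arrivals_window_le (hQ : QueueHyps U v Z0 vt) (hμ : StateEqns U v Z0 vt μ S)
    (ν : Measure ℝ) [IsFiniteMeasure ν] {ε κ r y t t' : ℝ} {N : ℕ} (hε : 0 < ε) (hκ : 0 < κ)
    (hr : 0 < r) (hy : 0 ≤ y) (ht : 0 ≤ t) (htt' : t ≤ t')
    (hN : (y + (S t' - S t) + κ) / κ < N + 1)
    (hbins : ∀ k : ℕ, k ≤ N → (1 / r) * (∑ i ∈ Finset.Ioc (Ecount U t) (Ecount U t'),
          if (k : ℝ) * κ ≤ v i ∧ v i < ((k : ℝ) + 1) * κ then (1 : ℝ) else 0)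
        ≤ (ε / 8) * (ν (Ico (((k : ℝ) - 1 / 2) * κ) (((k : ℝ) + 3 / 2) * κ))).toReal) :
    (1 / r) * ∑ i ∈ Finset.Ioc (Ecount U t) (Ecount U t'), window κ y (v i - S t' + S (U i)) ≤
      (ε / 8) * (2 * ((ν (Ici (y - 3 / 2 * κ))).toReal
        - (ν (Ici (y + (S t' - S t) + κ + 3 / 2 * κ))).toReal)) := by
  set z := y + (S t' - S t) + κ with hz
  have hS := service_mono hQ hμ ht htt'
  have hpt : ∀ i ∈ Finset.Ioc (Ecount U t) (Ecount U t'), window κ y (v i - S t' + S (U i)) ≤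
      ∑ k ∈ Finset.Icc ⌊y / κ⌋₊ ⌊z / κ⌋₊,
        if (k : ℝ) * κ ≤ v i ∧ v i < ((k : ℝ) + 1) * κ then (1 : ℝ) else 0 := by
    intro i hi
    rw [Finset.mem_Ioc] at hi
    have hU1 : t < U i := by
      by_contra! h
      exact absurd ((le_Ecount_iff hQ ht i).2 h) (by omega)
    have hU2 : U i ≤ t' := (le_Ecount_iff hQ (ht.trans htt') i).1 hi.2
    have hS1 := service_mono hQ hμ ht hU1.le
    have hS2 := service_mono hQ hμ (ht.trans hU1.le) hU2
    refine window_le_of_mem (Finset.sum_nonneg fun k _ => by split_ifs <;> simp)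
      fun h0 h1 h2 => ?_
    have hv : 0 ≤ v i / κ := div_nonneg (by linarith) hκ.le
    have hmem : ⌊v i / κ⌋₊ ∈ Finset.Icc ⌊y / κ⌋₊ ⌊z / κ⌋₊ :=
      Finset.mem_Icc.2 ⟨Nat.floor_le_floor (by gcongr; linarith),
        Nat.floor_le_floor (by gcongr; linarith)⟩
    refine le_trans (le_of_eq ?_) (Finset.single_le_sum (f := fun k : ℕ =>
      if (k : ℝ) * κ ≤ v i ∧ v i < ((k : ℝ) + 1) * κ then (1 : ℝ) else 0)
      (fun k _ => by split_ifs <;> simp) hmem)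
    rw [if_pos ⟨(le_div_iff₀ hκ).1 (Nat.floor_le hv),
      (div_lt_iff₀ hκ).1 (Nat.lt_floor_add_one _)⟩]
  calc _ ≤ (1 / r) * ∑ i ∈ Finset.Ioc (Ecount U t) (Ecount U t'),
        ∑ k ∈ Finset.Icc ⌊y / κ⌋₊ ⌊z / κ⌋₊,
          (if (k : ℝ) * κ ≤ v i ∧ v i < ((k : ℝ) + 1) * κ then (1 : ℝ) else 0) := by
        gcongr with i hi
        exact hpt i hi
    _ = ∑ k ∈ Finset.Icc ⌊y / κ⌋₊ ⌊z / κ⌋₊, (1 / r) *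
        ∑ i ∈ Finset.Ioc (Ecount U t) (Ecount U t'),
          (if (k : ℝ) * κ ≤ v i ∧ v i < ((k : ℝ) + 1) * κ then (1 : ℝ) else 0) := by
        rw [Finset.sum_comm, Finset.mul_sum]
    _ ≤ ∑ k ∈ Finset.Icc ⌊y / κ⌋₊ ⌊z / κ⌋₊,
        (ε / 8) * (ν (Ico (((k : ℝ) - 1 / 2) * κ) (((k : ℝ) + 3 / 2) * κ))).toReal := by
        refine Finset.sum_le_sum fun k hk => hbins k ?_
        refine (Finset.mem_Icc.1 hk).2.trans (Nat.lt_succ_iff.1 ?_)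
        exact (Nat.floor_lt (div_nonneg (by linarith) hκ.le)).2 (by push_cast; exact hN)
    _ ≤ _ := by
        rw [← Finset.mul_sum]
        gcongr
        exact sum_bins_le ν hκ hy (by linarith)

/-- Potential that dominates the accumulated contributions of the arrivals to a window. -/
noncomputable def tailPotential (ν : Measure ℝ) (κ y : ℝ) : ℝ :=
  2 * ((ν (Ici (y - 3 / 2 * κ))).toReal + (ν (Ici (y + 1 / 2 * κ))).toReal
    + (ν (Ici (y + 5 / 2 * κ))).toReal)

lemma tailPotential_nonneg (ν : Measure ℝ) (κ y : ℝ) : 0 ≤ tailPotential ν κ y := by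
  unfold tailPotential; positivity

lemma tailPotential_le (ν : Measure ℝ) [IsProbabilityMeasure ν] (κ y : ℝ) :
    tailPotential ν κ y ≤ 6 := by
  have h : ∀ x, (ν (Ici x)).toReal ≤ 1 := fun x =>
    ENNReal.toReal_le_of_le_ofReal zero_le_one (by simpa using prob_le_one)
  unfold tailPotential
  linarith [h (y - 3 / 2 * κ), h (y + 1 / 2 * κ), h (y + 5 / 2 * κ)]

lemma tailPotential_step (ν : Measure ℝ) [IsFiniteMeasure ν] {κ y Δ : ℝ} (hΔ : 2 * κ ≤ Δ) :
    2 * ((ν (Ici (y - 3 / 2 * κ))).toReal - (ν (Ici (y + Δ + κ + 3 / 2 * κ))).toReal)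
      + tailPotential ν κ (y + Δ) ≤ tailPotential ν κ y := by
  have hanti := toReal_Ici_antitone ν
  have h1 : (ν (Ici (y + Δ - 3 / 2 * κ))).toReal ≤ (ν (Ici (y + 1 / 2 * κ))).toReal :=
    hanti (by linarith)
  have h2 : (ν (Ici (y + Δ + 1 / 2 * κ))).toReal ≤ (ν (Ici (y + 5 / 2 * κ))).toReal :=
    hanti (by linarith)
  have h3 : y + Δ + κ + 3 / 2 * κ = y + Δ + 5 / 2 * κ := by ring
  unfold tailPotential
  rw [h3]
  linarith

/-- The bounds on a path, on the fluid scaled time interval `[0, τ]`, from which the mass of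
windows of length `κ` is controlled. -/
structure WindowBounds (U v : ℕ → ℝ) (Z0 : ℕ) (vt : ℕ → ℝ) (S : ℝ → ℝ) (ν : Measure ℝ)
    (r τ ε l κ M : ℝ) : Prop where
  arrivals : ∀ u ∈ Icc (0 : ℝ) τ,
    (1 / r) * ((Ecount U (r * (u + l)) : ℝ) - Ecount U (r * u)) ≤ ε / 16
  mass_le : ∀ u ∈ Icc (0 : ℝ) τ,
    (1 / r) * jobSum U v Z0 vt S (fun x => if 0 < x then 1 else 0) (r * u) ≤ M
  work_le : ∀ u ∈ Icc (0 : ℝ) τ,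
    (1 / r) * jobSum U v Z0 vt S (fun x => if 0 < x then x else 0) (r * u) ≤ M
  initial : ∀ y, 0 ≤ y → (1 / r) * jobSum U v Z0 vt S (window κ y) 0 ≤ ε / 4
  bins : ∀ u ∈ Icc (0 : ℝ) τ, ∀ k : ℕ, k ≤ ⌈64 * M ^ 2 / (κ * ε ^ 2)⌉₊ + 1 →
    (1 / r) * (∑ i ∈ Finset.Ioc (Ecount U (r * u)) (Ecount U (r * (u + l))),
        if (k : ℝ) * κ ≤ v i ∧ v i < ((k : ℝ) + 1) * κ then (1 : ℝ) else 0)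
      ≤ (ε / 8) * (ν (Ico (((k : ℝ) - 1 / 2) * κ) (((k : ℝ) + 3 / 2) * κ))).toReal

lemma WindowBounds.arrivals_le {ν : Measure ℝ} {r τ ε l κ M : ℝ}
    (hB : WindowBounds U v Z0 vt S ν r τ ε l κ M) (hQ : QueueHyps U v Z0 vt) (hr : 0 < r)
    {t t' : ℝ} (ht : t ∈ Icc 0 τ) (htt' : t ≤ t') (htl : t' ≤ t + l) :
    (1 / r) * ((Ecount U (r * t') : ℝ) - Ecount U (r * t)) ≤ ε / 16 := by
  refine le_trans ?_ (hB.arrivals t ht)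
  have : (Ecount U (r * t') : ℝ) ≤ Ecount U (r * (t + l)) := by
    exact_mod_cast Ecount_mono hQ (mul_nonneg hr.le (ht.1.trans htt')) (by gcongr)
  gcongr

lemma WindowBounds.window_far_le {ν : Measure ℝ} {r τ ε l κ M : ℝ}
    (hB : WindowBounds U v Z0 vt S ν r τ ε l κ M) (hr : 0 < r) (hε : 0 < ε) (hM : 1 < M)
    {u y : ℝ} (hu : u ∈ Icc 0 τ) (hy : 4 * M / ε ≤ y) :
    (1 / r) * jobSum U v Z0 vt S (window κ y) (r * u) ≤ ε / 4 := by
  have hM0 : 0 < M := by linarith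
  have hle : jobSum U v Z0 vt S (window κ y) (r * u) ≤
      ε / (4 * M) * jobSum U v Z0 vt S (fun x => if 0 < x then x else 0) (r * u) := by
    rw [← jobSum_const_mul]
    refine jobSum_mono (fun x => window_le_of_mem ?_ fun h0 h1 _ => ?_) _
    · split_ifs with h
      · positivity
      · simp
    · rw [if_pos h0]
      calc (1 : ℝ) = ε / (4 * M) * (4 * M / ε) := by field_simp
        _ ≤ ε / (4 * M) * x := by gcongr; exact hy.trans h1
  calc _ ≤ (1 / r) * (ε / (4 * M) *
        jobSum U v Z0 vt S (fun x => if 0 < x then x else 0) (r * u)) := by gcongr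
    _ = ε / (4 * M) * ((1 / r) *
        jobSum U v Z0 vt S (fun x => if 0 < x then x else 0) (r * u)) := by ring
    _ ≤ ε / (4 * M) * M := by gcongr; exact hB.work_le u hu
    _ = ε / 4 := by field_simp

lemma WindowBounds.window_le_potential {ν : Measure ℝ} [IsProbabilityMeasure ν]
    {r τ ε l κ M : ℝ}
    (hB : WindowBounds U v Z0 vt S ν r τ ε l κ M) (hQ : QueueHyps U v Z0 vt)
    (hμ : StateEqns U v Z0 vt μ S) (hr : 0 < r) (hε : 0 < ε) (hε1 : ε < 1) (hM : 1 < M)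
    (hl : 0 < l) (hκ : 0 < κ) (hκl : κ < l / (2 * M)) (n : ℕ) :
    ∀ u ∈ Icc (0 : ℝ) τ, u < n * l → ∀ y, 0 ≤ y →
      (1 / r) * jobSum U v Z0 vt S (window κ y) (r * u) ≤
        5 / 16 * ε + ε / 8 * tailPotential ν κ y := by
  have hM0 : 0 < M := by linarith
  have hcrude : ∀ s ∈ Icc (0 : ℝ) τ, ∀ u, s ≤ u → u ≤ s + l → ∀ y,
      (1 / r) * jobSum U v Z0 vt S (window κ y) (r * u) ≤
        (1 / r) * jobSum U v Z0 vt S (window κ (y + (S (r * u) - S (r * s)))) (r * s)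
          + ε / 16 := by
    intro s hs u hsu hul y
    have h0 : 0 ≤ r * s := mul_nonneg hr.le hs.1
    have h1 : r * s ≤ r * u := by gcongr
    have hS := service_mono hQ hμ h0 h1
    calc _ ≤ (1 / r) * (jobSum U v Z0 vt S (window κ (y + (S (r * u) - S (r * s)))) (r * s)
          + ((Ecount U (r * u) : ℝ) - Ecount U (r * s))) := by
          gcongr
          refine (jobSum_le_add_arrivals hQ (window_le_one κ y) h0 h1).trans ?_
          gcongr
          exact jobSum_mono (fun x => window_sub_le (by linarith)) _
      _ ≤ _ := by
          rw [mul_add]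
          gcongr
          exact hB.arrivals_le hQ hr hs hsu hul
  induction n with
  | zero => intro u hu h; simp only [Nat.cast_zero, zero_mul] at h; linarith [hu.1]
  | succ n ih =>
    intro u hu hun y hy
    have hpot := mul_nonneg (by positivity : 0 ≤ ε / 8) (tailPotential_nonneg ν κ y)
    rcases lt_or_ge u l with hul | hul
    · have h := hcrude 0 ⟨le_rfl, hu.1.trans hu.2⟩ u hu.1 (by linarith) y
      rw [mul_zero] at h
      have hS := service_mono hQ hμ le_rfl (mul_nonneg hr.le hu.1)
      have := hB.initial (y + (S (r * u) - S 0)) (by linarith)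
      linarith
    have hs : u - l ∈ Icc 0 τ := ⟨by linarith, by linarith [hu.2]⟩
    have h0 : 0 ≤ r * (u - l) := mul_nonneg hr.le hs.1
    have h1 : r * (u - l) ≤ r * u := by gcongr; linarith
    have hS := service_mono hQ hμ h0 h1
    by_cases hidle : ∃ s ∈ Icc (u - l) u, mass (μ (r * s)) = 0
    · obtain ⟨s, hs', hs0⟩ := hidle
      have hsτ : s ∈ Icc 0 τ := ⟨hs.1.trans hs'.1, hs'.2.trans hu.2⟩
      have h := hcrude s hsτ u hs'.2 (by linarith [hs'.1]) y
      have hz : jobSum U v Z0 vt S (window κ (y + (S (r * u) - S (r * s)))) (r * s) ≤ 0 := by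
        rw [← hs0, mass_eq_jobSum hμ (mul_nonneg hr.le hsτ.1)]
        exact jobSum_mono (fun x => window_le_of_mem (by split_ifs <;> simp)
          fun h _ _ => by simp [h]) _
      have := mul_nonpos_of_nonneg_of_nonpos (by positivity : 0 ≤ 1 / r) hz
      linarith
    push Not at hidle
    set Δ := S (r * u) - S (r * (u - l)) with hΔdef
    rcases le_or_gt (4 * M / ε) (y + Δ) with hfar | hnear
    · have h := hcrude (u - l) hs u (by linarith) (by linarith) y
      have := hB.window_far_le hr hε hM (κ := κ) hs hfar
      linarith
    have hΔ : 2 * κ ≤ Δ := by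
      have h := le_service_sub hQ hμ h0 h1 (C := r * M) fun s hsr => by
        have hsu : s / r ∈ Icc (u - l) u := by
          constructor
          · rw [le_div_iff₀ hr, mul_comm]; exact hsr.1
          · rw [div_le_iff₀ hr, mul_comm]; exact hsr.2
        have hrs : r * (s / r) = s := by field_simp
        have hne := hidle _ hsu
        have hm := hB.mass_le (s / r) ⟨hs.1.trans hsu.1, hsu.2.trans hu.2⟩
        rw [hrs] at hne hm
        rw [← mass_eq_jobSum hμ (h0.trans hsr.1), one_div, inv_mul_le_iff₀ hr] at hm
        exact ⟨lt_of_le_of_ne ENNReal.toReal_nonneg (Ne.symm hne), hm⟩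
      have h2 : (r * u - r * (u - l)) / (r * M) = 2 * (l / (2 * M)) := by field_simp; ring
      linarith
    have hblock := sum_arrivals_window_le hQ hμ ν (y := y)
      (N := ⌈64 * M ^ 2 / (κ * ε ^ 2)⌉₊ + 1) hε hκ hr hy h0 h1 (by
        have h3 : (y + Δ + κ) / κ < 4 * M / ε / κ + 1 := by
          rw [add_div, div_self hκ.ne']; gcongr
        have h4 : 4 * M / ε / κ ≤ 64 * M ^ 2 / (κ * ε ^ 2) := by
          rw [div_div, div_le_div_iff₀ (by positivity) (by positivity)]
          have : ε ≤ 16 * M := by linarith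
          calc 4 * M * (κ * ε ^ 2) = 4 * M * κ * ε * ε := by ring
            _ ≤ 4 * M * κ * ε * (16 * M) := by gcongr
            _ = 64 * M ^ 2 * (ε * κ) := by ring
        have h5 := Nat.le_ceil (64 * M ^ 2 / (κ * ε ^ 2))
        push_cast
        linarith)
      (by simpa using hB.bins (u - l) hs)
    have hind := ih (u - l) hs (by push_cast at hun; linarith) (y + Δ) (by linarith)
    have hstep := mul_le_mul_of_nonneg_left (tailPotential_step ν (y := y) hΔ)
      (by positivity : 0 ≤ ε / 8)
    have hshift : jobSum U v Z0 vt S (fun x => window κ y (x - Δ)) (r * (u - l)) ≤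
        jobSum U v Z0 vt S (window κ (y + Δ)) (r * (u - l)) :=
      jobSum_mono (fun x => window_sub_le (by linarith)) _
    rw [jobSum_eq_add hQ S _ h0 h1, mul_add]
    have := mul_le_mul_of_nonneg_left hshift (by positivity : 0 ≤ 1 / r)
    linarith

lemma WindowBounds.window_le {ν : Measure ℝ} [IsProbabilityMeasure ν] {r τ ε l κ M : ℝ}
    (hB : WindowBounds U v Z0 vt S ν r τ ε l κ M) (hQ : QueueHyps U v Z0 vt)
    (hμ : StateEqns U v Z0 vt μ S) (hr : 0 < r) (hε : 0 < ε) (hε1 : ε < 1) (hM : 1 < M)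
    (hl : 0 < l) (hκ : 0 < κ) (hκl : κ < l / (2 * M)) {u y : ℝ} (hu : u ∈ Icc 0 τ)
    (hy : 0 ≤ y) : (1 / r) * jobSum U v Z0 vt S (window κ y) (r * u) ≤ 2 * ε := by
  obtain ⟨n, hn⟩ := exists_nat_gt (u / l)
  have h := hB.window_le_potential hQ hμ hr hε hε1 hM hl hκ hκl n u hu
    ((div_lt_iff₀ hl).1 hn) y hy
  have := mul_le_mul_of_nonneg_left (tailPotential_le ν κ y) (by positivity : 0 ≤ ε / 8)
  linarith

lemma WindowBounds.of_goodPath {ν : Measure ℝ} {T L r ε l p κ γ M : ℝ}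
    (hG : GoodPath U v μ ν T L r ε l p κ γ M) (hμ : StateEqns U v Z0 vt μ S) (hr : 0 < r)
    (hL : 1 < L) : WindowBounds U v Z0 vt S ν r (⌊r * T⌋₊ + L) ε l κ M := by
  have key : ∀ u ∈ Icc (0 : ℝ) (⌊r * T⌋₊ + L), ∃ m : ℕ, m ≤ ⌊r * T⌋₊ ∧
      ∃ t ∈ Icc (0 : ℝ) L, u = m + t := by
    intro u hu
    refine ⟨min ⌊u⌋₊ ⌊r * T⌋₊, min_le_right _ _, u - (min ⌊u⌋₊ ⌊r * T⌋₊ : ℕ), ?_, by ring⟩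
    have h1 := Nat.floor_le hu.1
    have h2 := Nat.lt_floor_add_one u
    rcases le_total ⌊u⌋₊ ⌊r * T⌋₊ with h | h
    · rw [min_eq_left h]
      constructor <;> linarith
    · rw [min_eq_right h]
      have : (⌊r * T⌋₊ : ℝ) ≤ ⌊u⌋₊ := by exact_mod_cast h
      exact ⟨by linarith, by linarith [hu.2]⟩
  refine ⟨fun u hu => ?_, fun u hu => ?_, fun u hu => ?_, fun y hy => ?_, fun u hu => ?_⟩
  · obtain ⟨m, hm, t, ht, rfl⟩ := key u hu
    have := (hG m hm).1 t ht
    unfold fE at this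
    rwa [← sub_div, div_eq_inv_mul, ← one_div] at this
  · obtain ⟨m, hm, t, ht, rfl⟩ := key u hu
    rw [← pair_fmu hμ (fun _ => 1) hr hu.1, ← mass_eq_pair]
    exact (le_max_left _ _).trans ((le_max_left _ _).trans ((hG m hm).2.1 t ht))
  · obtain ⟨m, hm, t, ht, rfl⟩ := key u hu
    rw [← pair_fmu hμ (fun x => x) hr hu.1]
    exact (le_max_right _ _).trans ((le_max_left _ _).trans ((hG m hm).2.1 t ht))
  · have h := (hG 0 (Nat.zero_le _)).2.2.1 y hy
    rw [toReal_apply_eq_pair _ measurableSet_Icc, pair_fmu hμ _ hr le_rfl, mul_zero] at h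
    exact h
  · obtain ⟨m, hm, t, ht, rfl⟩ := key u hu
    exact (hG m hm).2.2.2.2 t ht

lemma abs_ite_pos_sub_le {f : ℝ → ℝ} {C κ Δ : ℝ} (hf : ∀ x, 0 ≤ f x ∧ f x ≤ 1)
    (hC : 0 ≤ C) (hlip : ∀ x y, |f x - f y| ≤ C * |x - y|) (hΔ : 0 ≤ Δ) (hΔκ : Δ ≤ κ) (x : ℝ) :
    |(if 0 < x - Δ then f (x - Δ) else 0) - (if 0 < x then f x else 0)| ≤
      C * Δ * (if 0 < x then 1 else 0) + window κ 0 x := by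
  have hw := window_nonneg κ 0 x
  rcases lt_or_ge 0 (x - Δ) with h | h
  · have hx : 0 < x := by linarith
    have := hlip (x - Δ) x
    rw [show |x - Δ - x| = Δ by rw [show x - Δ - x = -Δ by ring, abs_neg, abs_of_nonneg hΔ]] at this
    simp only [h, hx, if_true]
    linarith
  · rcases lt_or_ge 0 x with hx | hx
    · rw [window_eq_one hx hx.le (by linarith)]
      simp only [h.not_gt, hx, if_true, if_false, zero_sub, abs_neg, abs_of_nonneg (hf x).1]
      have := mul_nonneg hC hΔ
      linarith [(hf x).2]
    · simpa [h.not_gt, hx.not_gt] using hw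

/-- Oscillation over a short interval during which little service per job is provided. -/
lemma WindowBounds.abs_pair_sub_le_of_service_le {ν : Measure ℝ} [IsProbabilityMeasure ν]
    {r τ ε l κ M : ℝ}
    (hB : WindowBounds U v Z0 vt S ν r τ ε l κ M) (hQ : QueueHyps U v Z0 vt)
    (hμ : StateEqns U v Z0 vt μ S) (hr : 0 < r) (hε : 0 < ε) (hε1 : ε < 1) (hM : 1 < M)
    (hl : 0 < l) (hκ : 0 < κ) (hκl : κ < l / (2 * M)) {t t' : ℝ} (ht : t ∈ Icc 0 τ)
    (htt' : t ≤ t') (htl : t' ≤ t + l) (hΔκ : S (r * t') - S (r * t) ≤ κ)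
    {f : ℝ → ℝ} {C : ℝ} (hf : ∀ x, 0 ≤ f x ∧ f x ≤ 1)
    (hC : 0 ≤ C) (hlip : ∀ x y, |f x - f y| ≤ C * |x - y|) :
    |pair f (fmu μ r t') - pair f (fmu μ r t)| ≤
      3 * ε + C * (M * (S (r * t') - S (r * t))) := by
  have h0 : 0 ≤ r * t := mul_nonneg hr.le ht.1
  have h1 : r * t ≤ r * t' := by gcongr
  have hΔ : 0 ≤ S (r * t') - S (r * t) := by linarith [service_mono hQ hμ h0 h1]
  set Δ := S (r * t') - S (r * t) with hΔdef
  set F : ℝ → ℝ := fun x => if 0 < x then f x else 0 with hF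
  have hF01 : ∀ x, 0 ≤ F x ∧ F x ≤ 1 := fun x => by
    simp only [hF]
    split_ifs
    · exact hf x
    · simp
  have hshift : |jobSum U v Z0 vt S (fun x => F (x - Δ)) (r * t)
      - jobSum U v Z0 vt S F (r * t)| ≤
      C * Δ * jobSum U v Z0 vt S (fun x => if 0 < x then 1 else 0) (r * t)
        + jobSum U v Z0 vt S (window κ 0) (r * t) := by
    have heq : jobSum U v Z0 vt S (fun x => F (x - Δ)) (r * t) - jobSum U v Z0 vt S F (r * t) =
        jobSum U v Z0 vt S (fun x => F (x - Δ) - F x) (r * t) := by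
      rw [sub_eq_iff_eq_add, ← jobSum_add]
      simp
    rw [heq, ← jobSum_const_mul, ← jobSum_add]
    exact (abs_jobSum_le _ _).trans
      (jobSum_mono (fun x => abs_ite_pos_sub_le hf hC hlip hΔ hΔκ x) _)
  have harr : |∑ i ∈ Finset.Ioc (Ecount U (r * t)) (Ecount U (r * t')),
      F (v i - S (r * t') + S (U i))| ≤ (Ecount U (r * t') : ℝ) - Ecount U (r * t) := by
    rw [abs_of_nonneg (Finset.sum_nonneg fun _ _ => (hF01 _).1)]
    calc _ ≤ ∑ i ∈ Finset.Ioc (Ecount U (r * t)) (Ecount U (r * t')), (1 : ℝ) :=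
          Finset.sum_le_sum fun _ _ => (hF01 _).2
      _ = _ := by simp [Nat.cast_sub (Ecount_mono hQ h0 h1)]
  have hmass := hB.mass_le t ht
  have hwin := hB.window_le hQ hμ hr hε hε1 hM hl hκ hκl ht le_rfl
  have harr' := hB.arrivals_le hQ hr ht htt' htl
  rw [pair_fmu hμ f hr (ht.1.trans htt'), pair_fmu hμ f hr ht.1, jobSum_eq_add hQ S _ h0 h1,
    ← mul_sub, abs_mul, abs_of_pos (by positivity : 0 < 1 / r), add_sub_right_comm]
  calc _ ≤ (1 / r) * (C * Δ * jobSum U v Z0 vt S (fun x => if 0 < x then 1 else 0) (r * t)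
        + jobSum U v Z0 vt S (window κ 0) (r * t)
        + ((Ecount U (r * t') : ℝ) - Ecount U (r * t))) := by
        gcongr
        exact (abs_add_le _ _).trans (add_le_add hshift harr)
    _ = C * Δ * ((1 / r) * jobSum U v Z0 vt S (fun x => if 0 < x then 1 else 0) (r * t))
        + (1 / r) * jobSum U v Z0 vt S (window κ 0) (r * t)
        + (1 / r) * ((Ecount U (r * t') : ℝ) - Ecount U (r * t)) := by ring
    _ ≤ C * Δ * M + 2 * ε + ε / 16 := by gcongr
    _ ≤ _ := by linarith

lemma pair_mem_Icc_mass (hμ : StateEqns U v Z0 vt μ S) {f : ℝ → ℝ}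
    (hf : ∀ x, 0 ≤ f x ∧ f x ≤ 1) {r u : ℝ} (hr : 0 < r) (hu : 0 ≤ u) :
    pair f (fmu μ r u) ∈ Icc 0
      ((1 / r) * jobSum U v Z0 vt S (fun x => if 0 < x then 1 else 0) (r * u)) := by
  rw [pair_fmu hμ f hr hu]
  constructor
  · refine mul_nonneg (by positivity) (jobSum_nonneg (fun x => ?_) _)
    split_ifs
    · exact (hf x).1
    · exact le_rfl
  · gcongr
    refine jobSum_mono (fun x => ?_) _
    split_ifs
    · exact (hf x).2
    · exact le_rfl

/-- Oscillation over a short interval that starts with a small total mass. -/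
lemma WindowBounds.abs_pair_sub_le_of_mass_le {ν : Measure ℝ} {r τ ε l κ M : ℝ}
    (hB : WindowBounds U v Z0 vt S ν r τ ε l κ M) (hQ : QueueHyps U v Z0 vt)
    (hμ : StateEqns U v Z0 vt μ S) (hr : 0 < r) (hε : 0 < ε)
    {t t' : ℝ} (ht : t ∈ Icc 0 τ) (htt' : t ≤ t') (htl : t' ≤ t + l)
    (hmass : (1 / r) * jobSum U v Z0 vt S (fun x => if 0 < x then 1 else 0) (r * t) ≤ 4 * ε)
    {f : ℝ → ℝ} (hf : ∀ x, 0 ≤ f x ∧ f x ≤ 1) :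
    |pair f (fmu μ r t') - pair f (fmu μ r t)| ≤ 5 * ε := by
  have h0 : 0 ≤ r * t := mul_nonneg hr.le ht.1
  have h1 : r * t ≤ r * t' := by gcongr
  have hS := service_mono hQ hμ h0 h1
  have hp := pair_mem_Icc_mass hμ hf hr ht.1
  have hp' := pair_mem_Icc_mass hμ hf hr (ht.1.trans htt')
  have harr := hB.arrivals_le hQ hr ht htt' htl
  have hstep : jobSum U v Z0 vt S (fun x => if 0 < x then 1 else 0) (r * t') ≤
      jobSum U v Z0 vt S (fun x => if 0 < x then 1 else 0) (r * t)
        + ((Ecount U (r * t') : ℝ) - Ecount U (r * t)) := by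
    refine (jobSum_le_add_arrivals hQ (fun x => by split_ifs <;> simp) h0 h1).trans ?_
    gcongr
    refine jobSum_mono (fun x => ?_) _
    split_ifs with ha hb
    · exact le_rfl
    · exact absurd (by linarith) hb
    · exact zero_le_one
    · exact le_rfl
  have := mul_le_mul_of_nonneg_left hstep (by positivity : 0 ≤ 1 / r)
  rw [mul_add] at this
  rw [abs_le]
  constructor <;> linarith [hp.1, hp.2, hp'.1, hp'.2]

/-- If the total mass is small at some time then, by the moment bound and the small variation of
the workload, it is small at nearby earlier times. -/
lemma GoodPath.mass_le_of_mass_lt {ν : Measure ℝ} [IsProbabilityMeasure ν]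
    {T L r ε l p κ γ M A : ℝ}
    (hG : GoodPath U v μ ν T L r ε l p κ γ M) (hQ : QueueHyps U v Z0 vt)
    (hμ : StateEqns U v Z0 vt μ S) (hr : 0 < r) (hε : 0 < ε) (hε1 : ε < 1) (hM : 1 < M)
    (hl : 0 < l) (hκ : 0 < κ) (hκl : κ < l / (2 * M)) (hL : 1 < L) (hγ : γ < κ * ε / 4)
    (hp : 0 < p) (hA : 0 < A) (hAM : M * A ^ (-p) ≤ κ * ε / 2)
    {m : ℕ} (hm : m ≤ ⌊r * T⌋₊) {t s : ℝ} (ht : t ∈ Icc 0 L) (hs : s ∈ Icc 0 L)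
    (hmass : (1 / r) * jobSum U v Z0 vt S (fun x => if 0 < x then 1 else 0) (r * (m + s)) <
      κ * ε / (2 * A)) :
    (1 / r) * jobSum U v Z0 vt S (fun x => if 0 < x then 1 else 0) (r * (m + t)) ≤ 4 * ε := by
  have hB := WindowBounds.of_goodPath hG hμ hr hL
  have hm0 : (0 : ℝ) ≤ m := m.cast_nonneg
  have hmT : (m : ℝ) ≤ ⌊r * T⌋₊ := by exact_mod_cast hm
  obtain ⟨-, hmom, -, hwork, -⟩ := hG m hm
  have hms : 0 ≤ m + s := by linarith [hs.1]
  have hmt : 0 ≤ m + t := by linarith [ht.1]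
  have hmom' := (le_max_right _ _).trans (hmom s hs)
  have hws := abs_le.1 (hwork s hs)
  have hwt := abs_le.1 (hwork t ht)
  rw [pair_fmu hμ _ hr hms] at hmom'
  rw [pair_fmu hμ id hr hms] at hws
  rw [pair_fmu hμ id hr hmt] at hwt
  have hinv : 0 ≤ 1 / r := by positivity
  have hsmall : jobSum U v Z0 vt S (fun x => if 0 < x then id x else 0) (r * (m + s)) ≤
      A * jobSum U v Z0 vt S (fun x => if 0 < x then 1 else 0) (r * (m + s))
      + A ^ (-p) * jobSum U v Z0 vt S (fun x => if 0 < x then x ^ (1 + p) else 0)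
        (r * (m + s)) := by
    rw [← jobSum_const_mul, ← jobSum_const_mul, ← jobSum_add]
    refine jobSum_mono (fun x => ?_) _
    split_ifs with hx
    · have hpos : 0 ≤ A ^ (-p) * x ^ (1 + p) := by positivity
      rcases le_total x A with hxA | hxA
      · simp only [id, mul_one]; linarith
      · have h1 : 1 ≤ A ^ (-p) * x ^ p := by
          rw [Real.rpow_neg hA.le, inv_mul_eq_div, one_le_div (by positivity)]
          exact Real.rpow_le_rpow hA.le hxA hp.le
        rw [Real.rpow_add hx, Real.rpow_one]
        simp only [id, mul_one]
        nlinarith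
    · simp
  have hmassle : jobSum U v Z0 vt S (fun x => if 0 < x then 1 else 0) (r * (m + t)) ≤
      jobSum U v Z0 vt S (window κ 0) (r * (m + t))
      + κ⁻¹ * jobSum U v Z0 vt S (fun x => if 0 < x then id x else 0) (r * (m + t)) := by
    rw [← jobSum_const_mul, ← jobSum_add]
    refine jobSum_mono (fun x => ?_) _
    have hw := window_nonneg κ 0 x
    split_ifs with hx
    · rcases le_total x κ with hxκ | hxκ
      · rw [window_eq_one hx hx.le (by linarith)]
        simp only [id, le_add_iff_nonneg_right]
        positivity
      · have : 1 ≤ κ⁻¹ * x := by rwa [inv_mul_eq_div, one_le_div hκ]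
        simp only [id]
        linarith
    · simpa using hw
  have hwin := hB.window_le hQ hμ hr hε hε1 hM hl hκ hκl (u := m + t)
    ⟨hmt, by linarith [ht.2]⟩ le_rfl
  have hs1 := mul_le_mul_of_nonneg_left hsmall hinv
  have ht1 := mul_le_mul_of_nonneg_left hmassle hinv
  set X := jobSum U v Z0 vt S (fun x => if 0 < x then 1 else 0) (r * (m + s))
  set Y := jobSum U v Z0 vt S (fun x => if 0 < x then x ^ (1 + p) else 0) (r * (m + s))
  set W := jobSum U v Z0 vt S (fun x => if 0 < x then id x else 0) (r * (m + s))
  set W' := jobSum U v Z0 vt S (fun x => if 0 < x then id x else 0) (r * (m + t))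
  have hW : 1 / r * W ≤ κ * ε := by
    calc 1 / r * W ≤ A * (1 / r * X) + A ^ (-p) * (1 / r * Y) := by linarith
      _ ≤ A * (κ * ε / (2 * A)) + A ^ (-p) * M := by gcongr
      _ = κ * ε / 2 + M * A ^ (-p) := by field_simp
      _ ≤ κ * ε := by linarith
  have hW' : 1 / r * W' ≤ 2 * (κ * ε) := by
    have := mul_pos hκ hε
    linarith [hws.1, hws.2, hwt.1, hwt.2]
  calc _ ≤ 2 * ε + κ⁻¹ * (1 / r * W') := by linarith
    _ ≤ 2 * ε + κ⁻¹ * (2 * (κ * ε)) := by gcongr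
    _ = 4 * ε := by field_simp; ring

/-- Uniform oscillation bound for a bounded Lipschitz test function on a good path. -/
lemma GoodPath.abs_pair_sub_le {ν : Measure ℝ} [IsProbabilityMeasure ν]
    {T L r ε l p κ γ M A δ b : ℝ}
    (hG : GoodPath U v μ ν T L r ε l p κ γ M) (hQ : QueueHyps U v Z0 vt)
    (hμ : StateEqns U v Z0 vt μ S) (hr : 0 < r) (hε : 0 < ε) (hε1 : ε < 1) (hM : 1 < M)
    (hl : 0 < l) (hκ : 0 < κ) (hκl : κ < l / (2 * M)) (hL : 1 < L) (hγ : γ < κ * ε / 4)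
    (hp : 0 < p) (hA : 0 < A) (hAM : M * A ^ (-p) ≤ κ * ε / 2) (hb : 0 ≤ b) (hδl : δ ≤ l)
    (hδκ : δ / (κ * ε / (2 * A)) ≤ κ) (hδb : M * (δ / (κ * ε / (2 * A))) ≤ b)
    {m : ℕ} (hm : m ≤ ⌊r * T⌋₊) {t h' : ℝ} (ht : t ∈ Icc 0 (L - δ)) (hh' : h' ∈ Icc 0 δ)
    {f : ℝ → ℝ} {C : ℝ} (hf : ∀ x, 0 ≤ f x ∧ f x ≤ 1)
    (hC : 0 ≤ C) (hlip : ∀ x y, |f x - f y| ≤ C * |x - y|) :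
    |pair f (fmu μ r (m + t + h')) - pair f (fmu μ r (m + t))| ≤ 5 * ε + C * b := by
  have hB := WindowBounds.of_goodPath hG hμ hr hL
  have hm0 : (0 : ℝ) ≤ m := m.cast_nonneg
  have hmT : (m : ℝ) ≤ ⌊r * T⌋₊ := by exact_mod_cast hm
  obtain ⟨ht0, ht1⟩ := ht
  obtain ⟨hh0, hh1⟩ := hh'
  have hmt : (m + t : ℝ) ∈ Icc (0 : ℝ) (⌊r * T⌋₊ + L) := ⟨by linarith, by linarith⟩
  have hc : 0 < κ * ε / (2 * A) := by positivity
  by_cases hlow : ∃ s ∈ Icc t (t + h'),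
      (1 / r) * jobSum U v Z0 vt S (fun x => if 0 < x then 1 else 0) (r * (m + s)) <
        κ * ε / (2 * A)
  · obtain ⟨s, hs, hmass⟩ := hlow
    have hle := GoodPath.mass_le_of_mass_lt hG hQ hμ hr hε hε1 hM hl hκ hκl hL hγ hp hA hAM hm
      (t := t) ⟨ht0, by linarith⟩ ⟨ht0.trans hs.1, by linarith [hs.2]⟩ hmass
    have := hB.abs_pair_sub_le_of_mass_le hQ hμ hr hε hmt (t' := m + t + h') (by linarith)
      (by linarith) hle hf
    linarith [mul_nonneg hC hb]
  · push Not at hlow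
    have h0 : 0 ≤ r * (m + t) := mul_nonneg hr.le hmt.1
    have h1 : r * (m + t) ≤ r * (m + t + h') := mul_le_mul_of_nonneg_left (by linarith) hr.le
    have hΔ : S (r * (m + t + h')) - S (r * (m + t)) ≤ δ / (κ * ε / (2 * A)) := by
      have h := service_sub_le hQ hμ h0 h1 (c := r * (κ * ε / (2 * A))) (by positivity)
        fun s hs => by
          have hs1 : m + t ≤ s / r := by rw [le_div_iff₀ hr, mul_comm]; exact hs.1
          have hs2 : s / r ≤ m + t + h' := by rw [div_le_iff₀ hr, mul_comm]; exact hs.2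
          have := hlow (s / r - m) ⟨by linarith, by linarith⟩
          rw [add_sub_cancel, mul_div_cancel₀ _ hr.ne', ← mass_eq_jobSum hμ (h0.trans hs.1),
            one_div, inv_mul_eq_div, le_div_iff₀ hr, mul_comm] at this
          exact this
      calc _ ≤ _ := h
        _ = h' / (κ * ε / (2 * A)) := by
          rw [show r * (m + t + h') - r * (m + t) = r * h' by ring, mul_div_mul_left _ _ hr.ne']
        _ ≤ _ := by gcongr
    have := hB.abs_pair_sub_le_of_service_le hQ hμ hr hε hε1 hM hl hκ hκl hmt
      (t' := m + t + h') (by linarith) (by linarith) (hΔ.trans hδκ) hf hC hlip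
    have hMb : M * (S (r * (m + t + h')) - S (r * (m + t))) ≤ b :=
      le_trans (by gcongr) hδb
    linarith [mul_le_mul_of_nonneg_left hMb hC]

lemma abs_sub_le_of_abs_deriv_le {f : ℝ → ℝ} {C : ℝ} (hf : ContDiff ℝ 1 f)
    (hC : ∀ x, |deriv f x| ≤ C) (x y : ℝ) : |f x - f y| ≤ C * |x - y| :=
  convex_univ.norm_image_sub_le_of_norm_deriv_le
    (fun z _ => (hf.differentiable one_ne_zero) z) (fun z _ => hC z) (mem_univ y) (mem_univ x)

lemma hasSum_two_inv_pow_succ : HasSum (fun k : ℕ => (2 : ℝ)⁻¹ ^ (k + 1)) 1 := by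
  have := (hasSum_geometric_of_lt_one (r := (2 : ℝ)⁻¹) (by norm_num) (by norm_num)).mul_left 2⁻¹
  convert! this using 1
  · ext k; rw [pow_succ']
  · norm_num

lemma summable_two_inv_pow_mul_min {x : ℕ → ℝ} (hx : ∀ k, 0 ≤ x k) :
    Summable fun k : ℕ => (2 : ℝ)⁻¹ ^ (k + 1) * min (x k) 1 :=
  hasSum_two_inv_pow_succ.summable.of_nonneg_of_le
    (fun k => mul_nonneg (by positivity) (le_min (hx k) zero_le_one))
    (fun k => mul_le_of_le_one_right (by positivity) (min_le_right _ _))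

lemma tendsto_tsum_min_mul (C : ℕ → ℝ) (hC : ∀ k, 0 ≤ C k) :
    Tendsto (fun b : ℝ => ∑' k : ℕ, (2 : ℝ)⁻¹ ^ (k + 1) * min (C k * b) 1)
      (nhdsWithin 0 (Ioi 0)) (nhds 0) := by
  have h := tendsto_tsum_of_dominated_convergence (𝓕 := nhdsWithin (0 : ℝ) (Ioi 0))
    (f := fun b k => (2 : ℝ)⁻¹ ^ (k + 1) * min (C k * b) 1) (g := fun _ => 0)
    hasSum_two_inv_pow_succ.summable (fun k => ?_) ?_
  · simpa using h
  · have hc : Continuous fun b : ℝ => (2 : ℝ)⁻¹ ^ (k + 1) * min (C k * b) 1 := by fun_prop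
    have := (hc.tendsto 0).mono_left (nhdsWithin_le_nhds (s := Ioi 0))
    simpa using this
  · filter_upwards [self_mem_nhdsWithin] with b hb k
    have hCb : 0 ≤ C k * b := mul_nonneg (hC k) (le_of_lt hb)
    rw [Real.norm_of_nonneg (mul_nonneg (by positivity) (le_min hCb zero_le_one))]
    exact mul_le_of_le_one_right (by positivity) (min_le_right _ _)

lemma dmet_le {g h : ℕ → ℝ → ℝ} {ζ₁ ζ₂ : Measure ℝ} {C : ℕ → ℝ} {a b : ℝ} (ha : 0 ≤ a)
    (hb : 0 ≤ b) (hC : ∀ k, 0 ≤ C k)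
    (hg : ∀ k, |pair (g k) ζ₁ - pair (g k) ζ₂| ≤ a + C k * b)
    (hh : ∀ k, |pair (h k) ζ₁ - pair (h k) ζ₂| ≤ a + 2 * b) :
    dmet g h ζ₁ ζ₂ ≤
      a + ∑' k : ℕ, (2 : ℝ)⁻¹ ^ (k + 1) * min (C k * b) 1 + (a + 2 * b) := by
  have hsum := summable_two_inv_pow_mul_min fun k => mul_nonneg (hC k) hb
  have hconst := hasSum_two_inv_pow_succ.mul_right a
  refine add_le_add ?_ (ciSup_le hh)
  rw [one_mul] at hconst
  rw [← hconst.tsum_eq, ← hconst.summable.tsum_add hsum]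
  refine (summable_two_inv_pow_mul_min fun k => abs_nonneg _).tsum_le_tsum (fun k => ?_)
    (hconst.summable.add hsum)
  rw [← mul_add]
  gcongr
  calc _ ≤ min (a + C k * b) 1 := min_le_min_right _ (hg k)
    _ ≤ min (a + C k * b) (a + 1) := min_le_min_left _ (by linarith)
    _ = a + min (C k * b) 1 := min_add_add_left _ _ _

end PSQ

open PSQ MeasureTheory in
/-- Theorem 3.14, oscillation bound. -/
theorem stmt_10 (α : ℝ) (hα : 0 < α) (ν : Measure ℝ) (hν : IsProbabilityMeasure ν)
    (hνsupp : ν (Set.Iio 0) = 0)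
    (T L : ℝ) (hT : 1 < T) (hL : 1 < L) (p M : ℝ) (hp : 0 < p) (hM : 1 < M)
    (εseq lseq κseq γseq : ℕ → ℝ)
    (hε : ∀ n, εseq n ∈ Set.Ioo (0:ℝ) 1) (hεanti : StrictAnti εseq)
    (hεlim : Tendsto εseq atTop (nhds 0))
    (hl : ∀ n, 0 < lseq n) (hκ : ∀ n, 0 < κseq n) (hγ : ∀ n, 0 < γseq n)
    (hlε : ∀ n, lseq n < εseq n/(32*α)) (hκl : ∀ n, κseq n < lseq n/(2*M))
    (hγc : ∀ n, γseq n < min (κseq n * εseq n/4) (lseq n/4))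
    (g h : ℕ → ℝ → ℝ) (hgh : MetricFamilies g h) :
    ∀ ε : ℝ, 0 < ε → ∃ δ : ℝ, 0 < δ ∧ ∃ nε : ℕ, ∀ n : ℕ, nε < n →
      ∀ r : ℝ, 0 < r →
      ∀ (U v : ℕ → ℝ) (Z0 : ℕ) (vt : ℕ → ℝ), QueueHyps U v Z0 vt →
      ∀ (μ : ℝ → Measure ℝ) (S : ℝ → ℝ), StateEqns U v Z0 vt μ S →
      (∀ n' : ℕ, n' ≤ n →
        GoodPath U v μ ν T L r (εseq n') (lseq n') p (κseq n') (γseq n') M) →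
      ∀ m : ℕ, m ≤ ⌊r*T⌋₊ →
        ∀ t ∈ Set.Icc (0:ℝ) (L-δ), ∀ h' ∈ Set.Icc (0:ℝ) δ,
          dmet g h (fmu μ r ((m:ℝ)+t+h')) (fmu μ r ((m:ℝ)+t)) ≤ ε := by
  obtain ⟨hg, hh, -⟩ := hgh
  choose C hC using fun k => (hg k).2.2
  have hC0 : ∀ k, 0 ≤ C k := fun k => (abs_nonneg _).trans (hC k 0)
  intro ε hεpos
  obtain ⟨n₀, hn₀⟩ := (hεlim.eventually_lt_const (by positivity : 0 < ε / 40)).exists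
  obtain ⟨b, ⟨hFb, hbε⟩, hb⟩ :=
    ((((tendsto_tsum_min_mul C hC0).eventually_lt_const (by positivity : 0 < ε / 4)).and
      ((eventually_lt_nhds (by positivity : 0 < ε / 8)).filter_mono nhdsWithin_le_nhds)).and
      self_mem_nhdsWithin).exists
  replace hb : 0 < b := hb
  have hε₀ := (hε n₀).1
  have hκ₀ := hκ n₀
  have hl₀ := hl n₀
  obtain ⟨A, hAM, hA⟩ := ((((tendsto_rpow_neg_atTop hp).const_mul M).eventually_le_const
    (by rw [mul_zero]; positivity : M * 0 < κseq n₀ * εseq n₀ / 2)).and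
    (Filter.eventually_gt_atTop 0)).exists
  have hM0 : 0 < M := by linarith
  set c := κseq n₀ * εseq n₀ / (2 * A) with hc
  have hc0 : 0 < c := by positivity
  refine ⟨min (lseq n₀) (min (κseq n₀ * c) (b * c / M)), by positivity, n₀, ?_⟩
  set δ := min (lseq n₀) (min (κseq n₀ * c) (b * c / M)) with hδ
  have hδl : δ ≤ lseq n₀ := min_le_left _ _
  have hδκ : δ / c ≤ κseq n₀ :=
    (div_le_iff₀ hc0).2 ((min_le_right _ _).trans (min_le_left _ _))
  have hδb : M * (δ / c) ≤ b := by
    have : δ ≤ b * c / M := (min_le_right _ _).trans (min_le_right _ _)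
    rw [le_div_iff₀ hM0] at this
    rw [← mul_div_assoc, div_le_iff₀ hc0]
    linarith
  intro n hn r hr U v Z0 vt hQ μ S hμ hG m hm t ht h' hh'
  have hosc : ∀ (f : ℝ → ℝ) (K : ℝ), (∀ x, 0 ≤ f x ∧ f x ≤ 1) → ContDiff ℝ 1 f →
      (∀ x, |deriv f x| ≤ K) →
      |pair f (fmu μ r (m + t + h')) - pair f (fmu μ r (m + t))| ≤ 5 * εseq n₀ + K * b :=
    fun f K hf hf1 hK => GoodPath.abs_pair_sub_le (hG n₀ hn.le) hQ hμ hr hε₀ (hε n₀).2 hM hl₀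
      hκ₀ (hκl n₀) hL ((hγc n₀).trans_le (min_le_left _ _)) hp hA hAM hb.le hδl hδκ hδb hm ht hh'
      hf ((abs_nonneg _).trans (hK 0)) (abs_sub_le_of_abs_deriv_le hf1 hK)
  have := dmet_le (by positivity) hb.le hC0
    (fun k => hosc (g k) (C k) (hg k).1 (hg k).2.1 (hC k))
    (fun k => hosc (h k) 2 (hh k).1 (hh k).2.1 (hh k).2.2.2.2)
  linarith
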